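/- Let 0 < η₁ < α₁ and let ξ = (α₁² + η₁²)/2 + (α₁² − η₁²)·K(η₁/α₁)/E(η₁/α₁). Then 0 ≤ (η₁² − α₁²)/2 + ξ/3 ≤ η₁²; that is, the nonnegative root of the quadratic factor λ² − ((η₁² − α₁²)/2 + ξ/3) appearing in g′_{α₁}(λ) + 12λ² − 4ξ = 12·((λ² − α₁²)/R_{α₁}(λ))·(λ² − ((η₁² − α₁²)/2 + ξ/3)) lies in the interval [0, η₁]. -/

import Mathlib

open Real

/-- The complete elliptic integral of the first kind,
`K(m) = ∫₀^{π/2} dθ/√(1 − m² sin²θ)`. -/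
noncomputable def ellipticK (m : ℝ) : ℝ :=
  ∫ θ in (0:ℝ)..(π / 2), 1 / Real.sqrt (1 - m ^ 2 * Real.sin θ ^ 2)

/-- The complete elliptic integral of the second kind,
`E(m) = ∫₀^{π/2} √(1 − m² sin²θ) dθ`. -/
noncomputable def ellipticE (m : ℝ) : ℝ :=
  ∫ θ in (0:ℝ)..(π / 2), Real.sqrt (1 - m ^ 2 * Real.sin θ ^ 2)

lemma one_sub_sq_mul_sin_sq_pos {m : ℝ} (hm : m ^ 2 < 1) (θ : ℝ) :
    0 < 1 - m ^ 2 * Real.sin θ ^ 2 := by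
  nlinarith [Real.sin_sq_le_one θ, sq_nonneg m, sq_nonneg (Real.sin θ)]

lemma continuous_sqrt_one_sub_sq_mul_sin_sq (m : ℝ) :
    Continuous fun θ : ℝ => Real.sqrt (1 - m ^ 2 * Real.sin θ ^ 2) := by
  fun_prop

lemma continuous_one_div_sqrt_one_sub_sq_mul_sin_sq {m : ℝ} (hm : m ^ 2 < 1) :
    Continuous fun θ : ℝ => 1 / Real.sqrt (1 - m ^ 2 * Real.sin θ ^ 2) :=
  continuous_const.div (continuous_sqrt_one_sub_sq_mul_sin_sq m)
    fun θ => (Real.sqrt_pos.2 (one_sub_sq_mul_sin_sq_pos hm θ)).ne'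

lemma ellipticE_pos {m : ℝ} (hm : m ^ 2 < 1) : 0 < ellipticE m :=
  intervalIntegral.intervalIntegral_pos_of_pos
    ((continuous_sqrt_one_sub_sq_mul_sin_sq m).intervalIntegrable _ _)
    (fun θ => Real.sqrt_pos.2 (one_sub_sq_mul_sin_sq_pos hm θ)) (by positivity)

lemma ellipticE_le_ellipticK {m : ℝ} (hm : m ^ 2 < 1) : ellipticE m ≤ ellipticK m := by
  refine intervalIntegral.integral_mono_on (by positivity)
    ((continuous_sqrt_one_sub_sq_mul_sin_sq m).intervalIntegrable _ _)
    ((continuous_one_div_sqrt_one_sub_sq_mul_sin_sq hm).intervalIntegrable _ _) fun θ _ => ?_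
  have hw := one_sub_sq_mul_sin_sq_pos hm θ
  rw [le_div_iff₀ (Real.sqrt_pos.2 hw), Real.mul_self_sqrt hw.le]
  nlinarith [mul_nonneg (sq_nonneg m) (sq_nonneg (Real.sin θ))]

lemma one_sub_sq_mul_ellipticK_le_ellipticE {m : ℝ} (hm : m ^ 2 < 1) :
    (1 - m ^ 2) * ellipticK m ≤ ellipticE m := by
  rw [ellipticK, ← intervalIntegral.integral_const_mul]
  refine intervalIntegral.integral_mono_on (by positivity)
    (((continuous_one_div_sqrt_one_sub_sq_mul_sin_sq hm).const_mul _).intervalIntegrable _ _)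
    ((continuous_sqrt_one_sub_sq_mul_sin_sq m).intervalIntegrable _ _) fun θ _ => ?_
  have hw := one_sub_sq_mul_sin_sq_pos hm θ
  rw [mul_one_div, div_le_iff₀ (Real.sqrt_pos.2 hw), Real.mul_self_sqrt hw.le]
  nlinarith [mul_le_mul_of_nonneg_left (Real.sin_sq_le_one θ) (sq_nonneg m)]

/-- With `ξ = (α₁² + η₁²)/2 + (α₁² − η₁²) K(η₁/α₁)/E(η₁/α₁)` for `0 < η₁ < α₁`, one has
`0 ≤ (η₁² − α₁²)/2 + ξ/3 ≤ η₁²`: the nonnegative root of the quadratic factor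
`λ² − ((η₁² − α₁²)/2 + ξ/3)` in `g'_{α₁}(λ) + 12λ² − 4ξ` lies in `[0, η₁]`. -/
theorem quadratic_root_in_band (η₁ α₁ : ℝ) (h₀ : 0 < η₁) (h₁ : η₁ < α₁) :
    0 ≤ (η₁ ^ 2 - α₁ ^ 2) / 2
        + ((α₁ ^ 2 + η₁ ^ 2) / 2
            + (α₁ ^ 2 - η₁ ^ 2) * ellipticK (η₁ / α₁) / ellipticE (η₁ / α₁)) / 3 ∧
    (η₁ ^ 2 - α₁ ^ 2) / 2
        + ((α₁ ^ 2 + η₁ ^ 2) / 2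
            + (α₁ ^ 2 - η₁ ^ 2) * ellipticK (η₁ / α₁) / ellipticE (η₁ / α₁)) / 3 ≤ η₁ ^ 2 := by
  have hα : 0 < α₁ := h₀.trans h₁
  have hm : (η₁ / α₁) ^ 2 < 1 := by
    rw [div_pow, div_lt_one (by positivity)]
    gcongr
  have hE := ellipticE_pos hm
  have hα_sq : (α₁ ^ 2 - η₁ ^ 2) = α₁ ^ 2 * (1 - (η₁ / α₁) ^ 2) := by
    field_simp
  have hpos : 0 ≤ α₁ ^ 2 - η₁ ^ 2 := by nlinarith
  have lower : α₁ ^ 2 - η₁ ^ 2 ≤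
      (α₁ ^ 2 - η₁ ^ 2) * ellipticK (η₁ / α₁) / ellipticE (η₁ / α₁) := by
    rw [le_div_iff₀ hE]
    exact mul_le_mul_of_nonneg_left (ellipticE_le_ellipticK hm) hpos
  have upper : (α₁ ^ 2 - η₁ ^ 2) * ellipticK (η₁ / α₁) / ellipticE (η₁ / α₁) ≤ α₁ ^ 2 := by
    rw [div_le_iff₀ hE, hα_sq, mul_assoc]
    exact mul_le_mul_of_nonneg_left (one_sub_sq_mul_ellipticK_le_ellipticE hm) (sq_nonneg _)
  constructor <;> nlinarith
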